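/- arXiv:1403.3901 — 8 statements merged into one kernel-verified Lean document; each statement's English description precedes it below -/
import Mathlib

section
/- The functions H and K on ℝ⁹ are in involution with respect to the Lie–Poisson bracket of e(3,2)*: the identity {H,K} = 0 holds at every point of ℝ⁹, for all real values of the parameters λ, ε₁, ε₂. -/
noncomputable section

/-- The phase space `ℝ⁹` with coordinates `(M₁,M₂,M₃,α₁,α₂,α₃,β₁,β₂,β₃)`. -/
abbrev V9 : Type := Fin 9 → ℝ

/-- Index of `M_i` among the nine coordinates. -/
def mIdx (i : Fin 3) : Fin 9 := ⟨i.1, by have := i.isLt; omega⟩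
/-- Index of `α_i` among the nine coordinates. -/
def aIdx (i : Fin 3) : Fin 9 := ⟨i.1 + 3, by have := i.isLt; omega⟩
/-- Index of `β_i` among the nine coordinates. -/
def bIdx (i : Fin 3) : Fin 9 := ⟨i.1 + 6, by have := i.isLt; omega⟩

/-- The Levi-Civita symbol `ε_{ijk} = ½(i−j)(j−k)(k−i)`. -/
def epsSym (i j k : Fin 3) : ℝ :=
  (((i.1 : ℝ) - (j.1 : ℝ)) * ((j.1 : ℝ) - (k.1 : ℝ)) * ((k.1 : ℝ) - (i.1 : ℝ))) / 2

/-- Partial derivative of `f : ℝ⁹ → ℝ` in the `i`-th coordinate direction. -/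
def pd (i : Fin 9) (f : V9 → ℝ) (x : V9) : ℝ := fderiv ℝ f x (Pi.single i 1)

/-- The Lie–Poisson bracket of the Lie coalgebra `e(3,2)*`. -/
def pb (f g : V9 → ℝ) (x : V9) : ℝ :=
  ∑ i : Fin 3, ∑ j : Fin 3, ∑ k : Fin 3, epsSym i j k *
    (pd (mIdx i) f x * pd (mIdx j) g x * x (mIdx k)
      + (pd (mIdx i) f x * pd (aIdx j) g x - pd (mIdx i) g x * pd (aIdx j) f x) * x (aIdx k)
      + (pd (mIdx i) f x * pd (bIdx j) g x - pd (mIdx i) g x * pd (bIdx j) f x) * x (bIdx k))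

/-- The Hamiltonian `H` of the generalized two-field gyrostat. -/
def Hfun (lam e1 e2 : ℝ) : V9 → ℝ := fun x =>
  x 0 ^ 2 + x 1 ^ 2 + 2 * x 2 ^ 2 + 2 * lam * x 2 - 2 * e2 * (x 3 + x 7)
    + 2 * e1 * (x 1 * x 5 - x 2 * x 4 + x 2 * x 6 - x 0 * x 8)

/-- `|α|²`. -/
def nA2 : V9 → ℝ := fun x => x 3 ^ 2 + x 4 ^ 2 + x 5 ^ 2
/-- `|β|²`. -/
def nB2 : V9 → ℝ := fun x => x 6 ^ 2 + x 7 ^ 2 + x 8 ^ 2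
/-- `α·β`. -/
def dotAB : V9 → ℝ := fun x => x 3 * x 6 + x 4 * x 7 + x 5 * x 8

/-- `ω_α = α·M`. -/
def wA : V9 → ℝ := fun x => x 3 * x 0 + x 4 * x 1 + x 5 * x 2
/-- `ω_β = β·M`. -/
def wB : V9 → ℝ := fun x => x 6 * x 0 + x 7 * x 1 + x 8 * x 2
/-- `ω_γ = M·(α×β)`. -/
def wG : V9 → ℝ := fun x =>
  x 0 * (x 4 * x 8 - x 7 * x 5) + x 1 * (x 5 * x 6 - x 3 * x 8) + x 2 * (x 3 * x 7 - x 4 * x 6)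

/-- The auxiliary function `Z₁`. -/
def Z1 (e1 e2 : ℝ) : V9 → ℝ := fun x =>
  (x 0 ^ 2 - x 1 ^ 2) / 2 + e2 * (x 3 - x 7)
    + e1 * (x 2 * (x 4 + x 6) - x 1 * x 5 - x 0 * x 8) + e1 ^ 2 * (nB2 x - nA2 x) / 2

/-- The auxiliary function `Z₂`. -/
def Z2 (e1 e2 : ℝ) : V9 → ℝ := fun x =>
  x 0 * x 1 + e2 * (x 4 + x 6) - e1 * (x 2 * (x 3 - x 7) + x 8 * x 1 - x 5 * x 0)
    - e1 ^ 2 * dotAB x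

/-- The first integral `K`. -/
def Kfun (lam e1 e2 : ℝ) : V9 → ℝ := fun x =>
  Z1 e1 e2 x ^ 2 + Z2 e1 e2 x ^ 2
    - lam * ((x 2 + lam) * (x 0 ^ 2 + x 1 ^ 2) + 2 * e2 * (x 5 * x 0 + x 8 * x 1))
    + lam * e1 ^ 2 * (nA2 x + nB2 x) * x 2
    + 2 * lam * e1 * (x 4 * x 0 ^ 2 - x 6 * x 1 ^ 2 - (x 3 - x 7) * x 0 * x 1)
    - 2 * lam * e1 ^ 2 * wG x

theorem differentiable_Z1 (e1 e2 : ℝ) : Differentiable ℝ (Z1 e1 e2) := by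
  unfold Z1 nA2 nB2
  fun_prop

theorem differentiable_Z2 (e1 e2 : ℝ) : Differentiable ℝ (Z2 e1 e2) := by
  unfold Z2 dotAB
  fun_prop

/-- The derivative of `Hfun` in the direction `v`. -/
theorem fderiv_Hfun_apply (lam e1 e2 : ℝ) (x v : V9) :
    fderiv ℝ (Hfun lam e1 e2) x v =
      2 * x 0 * v 0 + 2 * x 1 * v 1 + 4 * x 2 * v 2 + 2 * lam * v 2 - 2 * e2 * (v 3 + v 7)
        + 2 * e1 * (v 1 * x 5 + x 1 * v 5 - (v 2 * x 4 + x 2 * v 4)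
          + (v 2 * x 6 + x 2 * v 6) - (v 0 * x 8 + x 0 * v 8)) := by
  unfold Hfun
  simp (disch := fun_prop) [fderiv_fun_add, fderiv_fun_sub, fderiv_fun_mul, fderiv_fun_pow,
    fderiv_apply]
  ring

/-- The derivative of `Z1` in the direction `v`. -/
theorem fderiv_Z1_apply (e1 e2 : ℝ) (x v : V9) :
    fderiv ℝ (Z1 e1 e2) x v =
      x 0 * v 0 - x 1 * v 1 + e2 * (v 3 - v 7)
        + e1 * (v 2 * (x 4 + x 6) + x 2 * (v 4 + v 6) - (v 1 * x 5 + x 1 * v 5)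
          - (v 0 * x 8 + x 0 * v 8))
        + e1 ^ 2 * (x 6 * v 6 + x 7 * v 7 + x 8 * v 8 - x 3 * v 3 - x 4 * v 4 - x 5 * v 5) := by
  unfold Z1 nA2 nB2
  simp (disch := fun_prop) [fderiv_fun_add, fderiv_fun_sub, fderiv_fun_mul, fderiv_fun_pow,
    fderiv_apply, div_eq_mul_inv]
  ring

/-- The derivative of `Z2` in the direction `v`. -/
theorem fderiv_Z2_apply (e1 e2 : ℝ) (x v : V9) :
    fderiv ℝ (Z2 e1 e2) x v =
      v 0 * x 1 + x 0 * v 1 + e2 * (v 4 + v 6)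
        - e1 * (v 2 * (x 3 - x 7) + x 2 * (v 3 - v 7) + (v 8 * x 1 + x 8 * v 1)
          - (v 5 * x 0 + x 5 * v 0))
        - e1 ^ 2 * (v 3 * x 6 + x 3 * v 6 + v 4 * x 7 + x 4 * v 7 + v 5 * x 8 + x 5 * v 8) := by
  unfold Z2 dotAB
  simp (disch := fun_prop) [fderiv_fun_add, fderiv_fun_sub, fderiv_fun_mul, fderiv_fun_pow,
    fderiv_apply]
  ring

/-- The derivative of `Kfun` in the direction `v`. -/
theorem fderiv_Kfun_apply (lam e1 e2 : ℝ) (x v : V9) :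
    fderiv ℝ (Kfun lam e1 e2) x v =
      2 * Z1 e1 e2 x * fderiv ℝ (Z1 e1 e2) x v + 2 * Z2 e1 e2 x * fderiv ℝ (Z2 e1 e2) x v
        - lam * (v 2 * (x 0 ^ 2 + x 1 ^ 2) + (x 2 + lam) * (2 * x 0 * v 0 + 2 * x 1 * v 1)
          + 2 * e2 * (v 5 * x 0 + x 5 * v 0 + v 8 * x 1 + x 8 * v 1))
        + lam * e1 ^ 2 * (2 * (x 3 * v 3 + x 4 * v 4 + x 5 * v 5
            + x 6 * v 6 + x 7 * v 7 + x 8 * v 8) * x 2 + (nA2 x + nB2 x) * v 2)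
        + 2 * lam * e1 * (v 4 * x 0 ^ 2 + 2 * x 4 * x 0 * v 0 - v 6 * x 1 ^ 2
          - 2 * x 6 * x 1 * v 1 - (v 3 - v 7) * x 0 * x 1 - (x 3 - x 7) * v 0 * x 1
          - (x 3 - x 7) * x 0 * v 1)
        - 2 * lam * e1 ^ 2 * (v 0 * (x 4 * x 8 - x 7 * x 5) + v 1 * (x 5 * x 6 - x 3 * x 8)
          + v 2 * (x 3 * x 7 - x 4 * x 6)
          + x 0 * (v 4 * x 8 + x 4 * v 8 - v 7 * x 5 - x 7 * v 5)
          + x 1 * (v 5 * x 6 + x 5 * v 6 - v 3 * x 8 - x 3 * v 8)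
          + x 2 * (v 3 * x 7 + x 3 * v 7 - v 4 * x 6 - x 4 * v 6)) := by
  have h1 := differentiable_Z1 e1 e2
  have h2 := differentiable_Z2 e1 e2
  unfold Kfun nA2 nB2 wG
  simp (disch := fun_prop) [fderiv_fun_add, fderiv_fun_sub, fderiv_fun_mul, fderiv_fun_pow,
    fderiv_apply]
  ring

/-- `H` and `K` are in involution with respect to the Lie–Poisson bracket of `e(3,2)*`. -/
theorem involution_H_K (lam e1 e2 : ℝ) (x : V9) :
    pb (Hfun lam e1 e2) (Kfun lam e1 e2) x = 0 := by
  simp [pb, pd, Fin.sum_univ_three, mIdx, aIdx, bIdx, epsSym, fderiv_Hfun_apply,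
    fderiv_Kfun_apply, fderiv_Z1_apply, fderiv_Z2_apply, Pi.single_apply]
  simp only [Z1, Z2, nA2, nB2, dotAB]
  ring
end
end

section
/- The functions H and G on ℝ⁹ are in involution with respect to the Lie–Poisson bracket of e(3,2)*: the identity {H,G} = 0 holds at every point of ℝ⁹, for all real values of the parameters λ, ε₁, ε₂. -/
noncomputable section

/-- The first integral `G`. -/
def Gfun (lam e1 e2 : ℝ) : V9 → ℝ := fun x =>
  wA x ^ 2 + wB x ^ 2 + 2 * (x 2 + lam) * wG x - 2 * e2 * (nA2 x * x 7 + nB2 x * x 3)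
    + 2 * e1 * (nB2 x * (x 1 * x 5 - x 2 * x 4) - nA2 x * (x 0 * x 8 - x 2 * x 6))
    + 2 * dotAB x * (e2 * (x 4 + x 6) + e1 * (x 5 * x 0 - x 3 * x 2 + x 7 * x 2 - x 8 * x 1))

section PartialDerivatives

variable {f g : V9 → ℝ} {x : V9}

lemma pd_add (i : Fin 9) (hf : DifferentiableAt ℝ f x) (hg : DifferentiableAt ℝ g x) :
    pd i (fun y => f y + g y) x = pd i f x + pd i g x := by
  simp [pd, fderiv_fun_add hf hg]

lemma pd_sub (i : Fin 9) (hf : DifferentiableAt ℝ f x) (hg : DifferentiableAt ℝ g x) :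
    pd i (fun y => f y - g y) x = pd i f x - pd i g x := by
  simp [pd, fderiv_fun_sub hf hg]

lemma pd_mul (i : Fin 9) (hf : DifferentiableAt ℝ f x) (hg : DifferentiableAt ℝ g x) :
    pd i (fun y => f y * g y) x = f x * pd i g x + g x * pd i f x := by
  simp [pd, fderiv_fun_mul hf hg]

lemma pd_sq (i : Fin 9) (hf : DifferentiableAt ℝ f x) :
    pd i (fun y => f y ^ 2) x = 2 * f x * pd i f x := by
  simp only [pow_two, pd_mul i hf hf]
  ring

lemma pd_const (i : Fin 9) (c : ℝ) : pd i (fun _ => c) x = 0 := by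
  simp [pd]

lemma pd_coord (i j : Fin 9) : pd i (fun y => y j) x = if j = i then 1 else 0 := by
  have h : HasFDerivAt (fun y : V9 => y j) (ContinuousLinearMap.proj (R := ℝ) j) x :=
    hasFDerivAt_apply j x
  simp [pd, h.fderiv, Pi.single_apply]

@[fun_prop]
lemma differentiable_nA2 : Differentiable ℝ nA2 := by
  unfold nA2
  fun_prop

lemma pd_nA2 (i : Fin 9) : pd i nA2 x =
    ![0, 0, 0, 2 * x 3, 2 * x 4, 2 * x 5, 0, 0, 0] i := by
  unfold nA2
  simp (disch := fun_prop) only [pd_add, pd_sq, pd_coord]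
  fin_cases i <;> simp

@[fun_prop]
lemma differentiable_nB2 : Differentiable ℝ nB2 := by
  unfold nB2
  fun_prop

lemma pd_nB2 (i : Fin 9) : pd i nB2 x =
    ![0, 0, 0, 0, 0, 0, 2 * x 6, 2 * x 7, 2 * x 8] i := by
  unfold nB2
  simp (disch := fun_prop) only [pd_add, pd_sq, pd_coord]
  fin_cases i <;> simp

@[fun_prop]
lemma differentiable_dotAB : Differentiable ℝ dotAB := by
  unfold dotAB
  fun_prop

lemma pd_dotAB (i : Fin 9) : pd i dotAB x =
    ![0, 0, 0, x 6, x 7, x 8, x 3, x 4, x 5] i := by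
  unfold dotAB
  simp (disch := fun_prop) only [pd_add, pd_mul, pd_coord]
  fin_cases i <;> simp

@[fun_prop]
lemma differentiable_wA : Differentiable ℝ wA := by
  unfold wA
  fun_prop

lemma pd_wA (i : Fin 9) : pd i wA x =
    ![x 3, x 4, x 5, x 0, x 1, x 2, 0, 0, 0] i := by
  unfold wA
  simp (disch := fun_prop) only [pd_add, pd_mul, pd_coord]
  fin_cases i <;> simp

@[fun_prop]
lemma differentiable_wB : Differentiable ℝ wB := by
  unfold wB
  fun_prop

lemma pd_wB (i : Fin 9) : pd i wB x =
    ![x 6, x 7, x 8, 0, 0, 0, x 0, x 1, x 2] i := by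
  unfold wB
  simp (disch := fun_prop) only [pd_add, pd_mul, pd_coord]
  fin_cases i <;> simp

@[fun_prop]
lemma differentiable_wG : Differentiable ℝ wG := by
  unfold wG
  fun_prop

lemma pd_wG (i : Fin 9) : pd i wG x =
    ![x 4 * x 8 - x 7 * x 5, x 5 * x 6 - x 3 * x 8, x 3 * x 7 - x 4 * x 6,
      x 2 * x 7 - x 1 * x 8, x 0 * x 8 - x 2 * x 6, x 1 * x 6 - x 0 * x 7,
      x 1 * x 5 - x 2 * x 4, x 2 * x 3 - x 0 * x 5, x 0 * x 4 - x 1 * x 3] i := by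
  unfold wG
  simp (disch := fun_prop) only [pd_add, pd_sub, pd_mul, pd_coord]
  fin_cases i <;> simp <;> ring

lemma pd_Hfun (lam e1 e2 : ℝ) (i : Fin 9) : pd i (Hfun lam e1 e2) x =
    ![2 * x 0 - 2 * e1 * x 8, 2 * x 1 + 2 * e1 * x 5, 4 * x 2 + 2 * lam + 2 * e1 * (x 6 - x 4),
      -2 * e2, -2 * e1 * x 2, 2 * e1 * x 1,
      2 * e1 * x 2, -2 * e2, -2 * e1 * x 0] i := by
  unfold Hfun
  simp (disch := fun_prop) only [pd_add, pd_sub, pd_mul, pd_sq, pd_const, pd_coord]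
  fin_cases i <;> simp <;> ring

lemma pd_Gfun (lam e1 e2 : ℝ) (i : Fin 9) : pd i (Gfun lam e1 e2) x =
    ![2 * wA x * x 3 + 2 * wB x * x 6 + 2 * (x 2 + lam) * (x 4 * x 8 - x 7 * x 5)
        - 2 * e1 * nA2 x * x 8 + 2 * dotAB x * e1 * x 5,
      2 * wA x * x 4 + 2 * wB x * x 7 + 2 * (x 2 + lam) * (x 5 * x 6 - x 3 * x 8)
        + 2 * e1 * nB2 x * x 5 - 2 * dotAB x * e1 * x 8,
      2 * wA x * x 5 + 2 * wB x * x 8 + 2 * (x 2 + lam) * (x 3 * x 7 - x 4 * x 6) + 2 * wG x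
        - 2 * e1 * nB2 x * x 4 + 2 * e1 * nA2 x * x 6 + 2 * dotAB x * e1 * (x 7 - x 3),
      2 * wA x * x 0 + 2 * (x 2 + lam) * (x 2 * x 7 - x 1 * x 8) - 2 * e2 * x 7 * (2 * x 3)
        - 2 * e2 * nB2 x - 2 * e1 * (x 0 * x 8 - x 2 * x 6) * (2 * x 3)
        + 2 * (e2 * (x 4 + x 6) + e1 * (x 5 * x 0 - x 3 * x 2 + x 7 * x 2 - x 8 * x 1)) * x 6
        - 2 * dotAB x * e1 * x 2,
      2 * wA x * x 1 + 2 * (x 2 + lam) * (x 0 * x 8 - x 2 * x 6) - 2 * e2 * x 7 * (2 * x 4)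
        - 2 * e1 * (x 0 * x 8 - x 2 * x 6) * (2 * x 4) - 2 * e1 * nB2 x * x 2
        + 2 * (e2 * (x 4 + x 6) + e1 * (x 5 * x 0 - x 3 * x 2 + x 7 * x 2 - x 8 * x 1)) * x 7
        + 2 * dotAB x * e2,
      2 * wA x * x 2 + 2 * (x 2 + lam) * (x 1 * x 6 - x 0 * x 7) - 2 * e2 * x 7 * (2 * x 5)
        - 2 * e1 * (x 0 * x 8 - x 2 * x 6) * (2 * x 5) + 2 * e1 * nB2 x * x 1
        + 2 * (e2 * (x 4 + x 6) + e1 * (x 5 * x 0 - x 3 * x 2 + x 7 * x 2 - x 8 * x 1)) * x 8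
        + 2 * dotAB x * e1 * x 0,
      2 * wB x * x 0 + 2 * (x 2 + lam) * (x 1 * x 5 - x 2 * x 4) - 2 * e2 * x 3 * (2 * x 6)
        + 2 * e1 * (x 1 * x 5 - x 2 * x 4) * (2 * x 6) + 2 * e1 * nA2 x * x 2
        + 2 * (e2 * (x 4 + x 6) + e1 * (x 5 * x 0 - x 3 * x 2 + x 7 * x 2 - x 8 * x 1)) * x 3
        + 2 * dotAB x * e2,
      2 * wB x * x 1 + 2 * (x 2 + lam) * (x 2 * x 3 - x 0 * x 5) - 2 * e2 * x 3 * (2 * x 7)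
        - 2 * e2 * nA2 x + 2 * e1 * (x 1 * x 5 - x 2 * x 4) * (2 * x 7)
        + 2 * (e2 * (x 4 + x 6) + e1 * (x 5 * x 0 - x 3 * x 2 + x 7 * x 2 - x 8 * x 1)) * x 4
        + 2 * dotAB x * e1 * x 2,
      2 * wB x * x 2 + 2 * (x 2 + lam) * (x 0 * x 4 - x 1 * x 3) - 2 * e2 * x 3 * (2 * x 8)
        + 2 * e1 * (x 1 * x 5 - x 2 * x 4) * (2 * x 8) - 2 * e1 * nA2 x * x 0
        + 2 * (e2 * (x 4 + x 6) + e1 * (x 5 * x 0 - x 3 * x 2 + x 7 * x 2 - x 8 * x 1)) * x 5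
        - 2 * dotAB x * e1 * x 1] i := by
  unfold Gfun
  simp (disch := fun_prop) only [pd_add, pd_sub, pd_mul, pd_sq, pd_const, pd_coord,
    pd_nA2, pd_nB2, pd_dotAB, pd_wA, pd_wB, pd_wG]
  fin_cases i <;> simp <;> ring

end PartialDerivatives

/-- `H` and `G` are in involution with respect to the Lie–Poisson bracket of `e(3,2)*`. -/
theorem involution_H_G (lam e1 e2 : ℝ) (x : V9) :
    pb (Hfun lam e1 e2) (Gfun lam e1 e2) x = 0 := by
  simp only [pb, Fin.sum_univ_three, pd_Hfun, pd_Gfun]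
  simp [epsSym, mIdx, aIdx, bIdx, nA2, nB2, dotAB, wA, wB, wG]
  ring
end
end

section
/- The functions K and G on ℝ⁹ are in involution with respect to the Lie–Poisson bracket of e(3,2)*: the identity {K,G} = 0 holds at every point of ℝ⁹, for all real values of the parameters λ, ε₁, ε₂. -/
noncomputable section

/-- `f` is differentiable at `x` and its partial derivatives there are the entries of `g`. -/
def HasPartials (f : V9 → ℝ) (g : V9) (x : V9) : Prop :=
  DifferentiableAt ℝ f x ∧ ∀ i, pd i f x = g i

namespace HasPartials

variable {f g : V9 → ℝ} {f' g' x : V9}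

theorem coord (j : Fin 9) (x : V9) : HasPartials (fun y => y j) (Pi.single j 1) x := by
  refine ⟨by fun_prop, fun i => ?_⟩
  have h : HasFDerivAt (fun y : V9 => y j) (ContinuousLinearMap.proj (R := ℝ) j) x :=
    (ContinuousLinearMap.proj (R := ℝ) (φ := fun _ : Fin 9 => ℝ) j).hasFDerivAt
  simp [pd, h.fderiv, Pi.single_apply, eq_comm]

theorem const (c : ℝ) (x : V9) : HasPartials (fun _ => c) 0 x :=
  ⟨by fun_prop, fun i => by simp [pd]⟩

theorem add (hf : HasPartials f f' x) (hg : HasPartials g g' x) :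
    HasPartials (fun y => f y + g y) (f' + g') x :=
  ⟨hf.1.add hg.1, fun i => by
    rw [Pi.add_apply, ← hf.2 i, ← hg.2 i]; simp [pd, fderiv_fun_add hf.1 hg.1]⟩

theorem sub (hf : HasPartials f f' x) (hg : HasPartials g g' x) :
    HasPartials (fun y => f y - g y) (f' - g') x :=
  ⟨hf.1.sub hg.1, fun i => by
    rw [Pi.sub_apply, ← hf.2 i, ← hg.2 i]; simp [pd, fderiv_fun_sub hf.1 hg.1]⟩

theorem mul (hf : HasPartials f f' x) (hg : HasPartials g g' x) :
    HasPartials (fun y => f y * g y) (f x • g' + g x • f') x :=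
  ⟨hf.1.mul hg.1, fun i => by
    simp only [Pi.add_apply, Pi.smul_apply, ← hf.2 i, ← hg.2 i]
    simp [pd, fderiv_fun_mul hf.1 hg.1]⟩

theorem sq (hf : HasPartials f f' x) :
    HasPartials (fun y => f y ^ 2) ((2 * f x) • f') x := by
  simpa only [pow_two, two_mul, add_smul] using hf.mul hf

theorem div_const (hf : HasPartials f f' x) (c : ℝ) :
    HasPartials (fun y => f y / c) (c⁻¹ • f') x := by
  simpa [div_eq_inv_mul] using (const c⁻¹ x).mul hf

end HasPartials


/-- The value at `x` of the Lie–Poisson bivector on the covectors `u` and `v`. -/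
def poissonForm (x u v : V9) : ℝ :=
  (u 0 * v 1 - u 1 * v 0) * x 2 + (u 1 * v 2 - u 2 * v 1) * x 0
    + (u 2 * v 0 - u 0 * v 2) * x 1
    + (u 0 * v 4 - u 4 * v 0 + u 3 * v 1 - u 1 * v 3) * x 5
    + (u 1 * v 5 - u 5 * v 1 + u 4 * v 2 - u 2 * v 4) * x 3
    + (u 2 * v 3 - u 3 * v 2 + u 5 * v 0 - u 0 * v 5) * x 4
    + (u 0 * v 7 - u 7 * v 0 + u 6 * v 1 - u 1 * v 6) * x 8
    + (u 1 * v 8 - u 8 * v 1 + u 7 * v 2 - u 2 * v 7) * x 6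
    + (u 2 * v 6 - u 6 * v 2 + u 8 * v 0 - u 0 * v 8) * x 7

theorem poissonForm_add (x u u' v : V9) :
    poissonForm x (u + u') v = poissonForm x u v + poissonForm x u' v := by
  simp only [poissonForm, Pi.add_apply]; ring

theorem poissonForm_sub (x u u' v : V9) :
    poissonForm x (u - u') v = poissonForm x u v - poissonForm x u' v := by
  simp only [poissonForm, Pi.sub_apply]; ring

theorem poissonForm_smul (x u v : V9) (c : ℝ) :
    poissonForm x (c • u) v = c * poissonForm x u v := by
  simp only [poissonForm, Pi.smul_apply, smul_eq_mul]; ring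

theorem poissonForm_zero (x v : V9) : poissonForm x 0 v = 0 := by
  simp [poissonForm]

theorem HasPartials.pb_eq {f g : V9 → ℝ} {u v x : V9} (hf : HasPartials f u x)
    (hg : HasPartials g v x) : pb f g x = poissonForm x u v := by
  have hm : mIdx 0 = 0 ∧ mIdx 1 = 1 ∧ mIdx 2 = 2 := ⟨rfl, rfl, rfl⟩
  have ha : aIdx 0 = 3 ∧ aIdx 1 = 4 ∧ aIdx 2 = 5 := ⟨rfl, rfl, rfl⟩
  have hb : bIdx 0 = 6 ∧ bIdx 1 = 7 ∧ bIdx 2 = 8 := ⟨rfl, rfl, rfl⟩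
  simp only [pb, poissonForm, Fin.sum_univ_three, hf.2, hg.2, epsSym, hm, ha, hb]
  norm_num
  ring

set_option maxHeartbeats 1000000 in
/-- `K` and `G` are in involution with respect to the Lie–Poisson bracket of `e(3,2)*`. -/
theorem involution_K_G (lam e1 e2 : ℝ) (x : V9) :
    pb (Kfun lam e1 e2) (Gfun lam e1 e2) x = 0 := by
  rw [HasPartials.pb_eq (f := Kfun lam e1 e2) (g := Gfun lam e1 e2) (x := x)
    (by unfold Kfun Z1 Z2 wG nA2 nB2 dotAB
        repeat' first
          | exact HasPartials.const _ _ | exact HasPartials.coord _ _ | apply HasPartials.sq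
          | apply HasPartials.div_const | apply HasPartials.sub | apply HasPartials.add
          | apply HasPartials.mul)
    (by unfold Gfun wA wB wG nA2 nB2 dotAB
        repeat' first
          | exact HasPartials.const _ _ | exact HasPartials.coord _ _ | apply HasPartials.sq
          | apply HasPartials.div_const | apply HasPartials.sub | apply HasPartials.add
          | apply HasPartials.mul)]
  simp only [poissonForm_add, poissonForm_sub, poissonForm_smul, poissonForm_zero,
    mul_zero, add_zero]
  simp only [poissonForm, Pi.add_apply, Pi.sub_apply, Pi.smul_apply, Pi.zero_apply,
    Pi.single_apply, smul_eq_mul, Fin.reduceEq, if_true, if_false, mul_zero, zero_mul, mul_one,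
    one_mul, add_zero, zero_add, sub_zero, zero_sub]
  ring
end
end

section
/- For ε₂ = 0, the zero level of each of the functions F₁ and F₂ is invariant under the flow of the generalized two-field gyrostat: if γ: ℝ → ℝ⁹ is a differentiable solution of the equations of motion and F₁(γ(0)) = 0, then F₁(γ(t)) = 0 for all t ∈ ℝ; likewise, if F₂(γ(0)) = 0, then F₂(γ(t)) = 0 for all t ∈ ℝ. -/
noncomputable section

/-- Vectors in `ℝ³`. -/
abbrev R3 : Type := Fin 3 → ℝ

/-- The Hamiltonian `H` (with `ε₂ = 0`) as a function of `M`, `α`, `β`. -/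
def H3 (lam e1 : ℝ) (M a b : R3) : ℝ :=
  M 0 ^ 2 + M 1 ^ 2 + 2 * M 2 ^ 2 + 2 * lam * M 2
    + 2 * e1 * (M 1 * a 2 - M 2 * a 1 + M 2 * b 0 - M 0 * b 2)

/-- The gradient `∂H/∂M`. -/
def gradM (lam e1 : ℝ) (M a b : R3) : R3 := fun i =>
  fderiv ℝ (fun M' => H3 lam e1 M' a b) M (Pi.single i 1)
/-- The gradient `∂H/∂α`. -/
def gradA (lam e1 : ℝ) (M a b : R3) : R3 := fun i =>
  fderiv ℝ (fun a' => H3 lam e1 M a' b) a (Pi.single i 1)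
/-- The gradient `∂H/∂β`. -/
def gradB (lam e1 : ℝ) (M a b : R3) : R3 := fun i =>
  fderiv ℝ (fun b' => H3 lam e1 M a b') b (Pi.single i 1)

/-- A curve `(M,α,β) : ℝ → ℝ⁹` solves the equations of motion of the generalized
two-field gyrostat (with `ε₂ = 0`). -/
def SolvesEqs (lam e1 : ℝ) (γM γa γb : ℝ → R3) : Prop :=
  (∀ t, HasDerivAt γM
      (crossProduct (γM t) (gradM lam e1 (γM t) (γa t) (γb t))
        + crossProduct (γa t) (gradA lam e1 (γM t) (γa t) (γb t))
        + crossProduct (γb t) (gradB lam e1 (γM t) (γa t) (γb t))) t)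
  ∧ (∀ t, HasDerivAt γa (crossProduct (γa t) (gradM lam e1 (γM t) (γa t) (γb t))) t)
  ∧ (∀ t, HasDerivAt γb (crossProduct (γb t) (gradM lam e1 (γM t) (γa t) (γb t))) t)

/-- The invariant relation `F₁ = M₃ + λ + ε₁(β₁ − α₂)`. -/
def F1v (lam e1 : ℝ) (M a b : R3) : ℝ := M 2 + lam + e1 * (b 0 - a 1)

/-- The invariant relation `F₂`. -/
def F2v (lam e1 : ℝ) (M a b : R3) : ℝ :=
  M 2 ^ 3 + (e1 * (b 0 - a 1) + lam) * M 2 ^ 2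
    + (M 0 ^ 2 + M 1 ^ 2 + 2 * e1 * (a 2 * M 1 - b 2 * M 0)) * M 2
    + e1 * ((M 1 ^ 2 - M 0 ^ 2) * (a 1 + b 0) + 2 * M 0 * M 1 * (a 0 - b 1))
    + lam * (M 0 ^ 2 + M 1 ^ 2)

/-- A solution of a scalar linear homogeneous ODE that vanishes at `0` vanishes identically. -/
theorem eq_zero_of_hasDerivAt_mul {k f : ℝ → ℝ} (hk : Continuous k)
    (hf : ∀ t, HasDerivAt f (k t * f t) t) (h0 : f 0 = 0) (t : ℝ) : f t = 0 := by
  have hg : ∀ t, HasDerivAt (fun t => f t * Real.exp (-∫ s in (0 : ℝ)..t, k s)) 0 t := by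
    intro t
    have hK : HasDerivAt (fun t => ∫ s in (0 : ℝ)..t, k s) (k t) t :=
      (hk.integral_hasStrictDerivAt 0 t).hasDerivAt
    exact ((hf t).mul hK.fun_neg.exp).congr_deriv (by ring)
  have hc := is_const_of_deriv_eq_zero (fun t => (hg t).differentiableAt)
    (fun t => (hg t).deriv) t 0
  simpa [h0, Real.exp_ne_zero] using hc

theorem hasFDerivAt_coord (x : R3) (i : Fin 3) :
    HasFDerivAt (fun y : R3 => y i) (ContinuousLinearMap.proj (R := ℝ) i : R3 →L[ℝ] ℝ) x :=
  hasFDerivAt_apply i x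

theorem gradM_eq (lam e1 : ℝ) (M a b : R3) :
    gradM lam e1 M a b = ![2 * M 0 - 2 * e1 * b 2, 2 * M 1 + 2 * e1 * a 2,
      4 * M 2 + 2 * lam + 2 * e1 * (b 0 - a 1)] := by
  have c := hasFDerivAt_coord M
  have h := ((((c 0).pow 2).add ((c 1).pow 2)).add (((c 2).pow 2).const_mul 2)).add
    ((c 2).const_mul (2 * lam)) |>.add
    ((((((c 1).mul_const (a 2)).sub ((c 2).mul_const (a 1))).add
      ((c 2).mul_const (b 0))).sub ((c 0).mul_const (b 2))).const_mul (2 * e1))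
  have h' : fderiv ℝ (fun M' => H3 lam e1 M' a b) M = _ := HasFDerivAt.fderiv h
  ext i
  simp only [gradM, h']
  fin_cases i <;> simp <;> ring

theorem gradA_eq (lam e1 : ℝ) (M a b : R3) :
    gradA lam e1 M a b = ![0, -2 * e1 * M 2, 2 * e1 * M 1] := by
  have c := hasFDerivAt_coord a
  have h := ((((((c 2).const_mul (M 1)).sub ((c 1).const_mul (M 2))).add_const
    (M 2 * b 0)).sub_const (M 0 * b 2)).const_mul (2 * e1)).const_add
      (M 0 ^ 2 + M 1 ^ 2 + 2 * M 2 ^ 2 + 2 * lam * M 2)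
  have h' : fderiv ℝ (fun a' => H3 lam e1 M a' b) a = _ := HasFDerivAt.fderiv h
  ext i
  simp only [gradA, h']
  fin_cases i <;> simp

theorem gradB_eq (lam e1 : ℝ) (M a b : R3) :
    gradB lam e1 M a b = ![2 * e1 * M 2, 0, -2 * e1 * M 0] := by
  have c := hasFDerivAt_coord b
  have h := ((((c 0).const_mul (M 2)).const_add (M 1 * a 2 - M 2 * a 1)).sub
    ((c 2).const_mul (M 0))).const_mul (2 * e1) |>.const_add
      (M 0 ^ 2 + M 1 ^ 2 + 2 * M 2 ^ 2 + 2 * lam * M 2)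
  have h' : fderiv ℝ (fun b' => H3 lam e1 M a b') b = _ := HasFDerivAt.fderiv h
  ext i
  simp only [gradB, h']
  fin_cases i <;> simp

/-- For `ε₂ = 0`, the zero levels of `F₁` and `F₂` are invariant under the flow of the
generalized two-field gyrostat. -/
theorem invariance_F1_F2 (lam e1 : ℝ) (γM γa γb : ℝ → R3)
    (hsol : SolvesEqs lam e1 γM γa γb) :
    (F1v lam e1 (γM 0) (γa 0) (γb 0) = 0 → ∀ t : ℝ, F1v lam e1 (γM t) (γa t) (γb t) = 0)
    ∧ (F2v lam e1 (γM 0) (γa 0) (γb 0) = 0 → ∀ t : ℝ, F2v lam e1 (γM t) (γa t) (γb t) = 0) := by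
  obtain ⟨hM, ha, hb⟩ := hsol
  have cM := fun i t => hasDerivAt_pi.1 (hM t) i
  have ca := fun i t => hasDerivAt_pi.1 (ha t) i
  have cb := fun i t => hasDerivAt_pi.1 (hb t) i
  have hk : Continuous fun t => 2 * e1 * (γa t 0 + γb t 1) := by
    have h1 : Continuous fun t => γa t 0 :=
      continuous_iff_continuousAt.2 fun t => (ca 0 t).continuousAt
    have h2 : Continuous fun t => γb t 1 :=
      continuous_iff_continuousAt.2 fun t => (cb 1 t).continuousAt
    fun_prop
  constructor
  · refine eq_zero_of_hasDerivAt_mul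
      (f := fun t => F1v lam e1 (γM t) (γa t) (γb t)) hk fun t => ?_
    have h := ((cM 2 t).add_const lam).add (((cb 0 t).sub (ca 1 t)).const_mul e1)
    refine HasDerivAt.congr_deriv h ?_
    simp [gradM_eq, gradA_eq, gradB_eq, cross_apply, F1v]
    ring
  · refine eq_zero_of_hasDerivAt_mul
      (f := fun t => F2v lam e1 (γM t) (γa t) (γb t)) hk.neg fun t => ?_
    have h := ((((cM 2 t).pow 3).add
      (((((cb 0 t).sub (ca 1 t)).const_mul e1).add_const lam).mul ((cM 2 t).pow 2))).add
      (((((cM 0 t).pow 2).add ((cM 1 t).pow 2)).add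
        ((((ca 2 t).mul (cM 1 t)).sub ((cb 2 t).mul (cM 0 t))).const_mul (2 * e1))).mul
          (cM 2 t))).add
      ((((((cM 1 t).pow 2).sub ((cM 0 t).pow 2)).mul ((ca 1 t).add (cb 0 t))).add
        ((((cM 0 t).const_mul 2).mul (cM 1 t)).mul ((ca 0 t).sub (cb 1 t)))).const_mul e1) |>.add
      ((((cM 0 t).pow 2).add ((cM 1 t).pow 2)).const_mul lam)
    refine HasDerivAt.congr_deriv h ?_
    simp [gradM_eq, gradA_eq, gradB_eq, cross_apply, F2v]
    ring
end
end

section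
/- For ε₂ = 0, the function Φ₂ vanishes on the invariant set M_{L₂}: at every point x ∈ ℝ⁹ with M₁ = 0 and M₂ = 0 one has Φ₂(x) = 0, for all real values of λ and ε₁. -/
noncomputable section

/-- The integral `Φ₂ = 4K − ε₁²[2H(|α|²+|β|²) − 4G + ε₁²(4(α·β)² + (|α|²−|β|²)²)]`
(for `ε₂ = 0`). -/
def Phi2 (lam e1 : ℝ) : V9 → ℝ := fun x =>
  4 * Kfun lam e1 0 x - e1 ^ 2 * (2 * Hfun lam e1 0 x * (nA2 x + nB2 x) - 4 * Gfun lam e1 0 x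
    + e1 ^ 2 * (4 * dotAB x ^ 2 + (nA2 x - nB2 x) ^ 2))

/-- For `ε₂ = 0`, the integral `Φ₂` vanishes on the invariant set `M_{L₂} = {M₁ = M₂ = 0}`. -/
theorem Phi2_vanishes (lam e1 : ℝ) (x : V9) (h1 : x 0 = 0) (h2 : x 1 = 0) :
    Phi2 lam e1 x = 0 := by
  simp only [Phi2, Kfun, Hfun, Gfun, Z1, Z2, wA, wB, wG, nA2, nB2, dotAB, h1, h2]
  ring
end
end

section
/- For ε₂ = 0, the Hamiltonian vector field of Φ₂ vanishes on the invariant set M_{L₂}: at every point x ∈ ℝ⁹ with M₁ = 0 and M₂ = 0, all nine components {Φ₂,M_i}(x), {Φ₂,α_i}(x), {Φ₂,β_i}(x) (i = 1,2,3) of sgrad Φ₂ are zero, for all real values of λ and ε₁. -/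
noncomputable section

/-- The Hamiltonian vector field `sgrad f`, whose nine components are the Poisson brackets
of `f` with the nine coordinate functions. -/
def sgrad (f : V9 → ℝ) (x : V9) : V9 := fun j => pb f (fun y => y j) x

/-- Coefficient of `M₁²` in the expansion of `Φ₂` near `M₁ = M₂ = 0`. -/
def Phi2CoeffSqM1 (lam e1 : ℝ) : V9 → ℝ := fun x =>
  x 0 ^ 2 + x 1 ^ 2 + 4 * (Z1 e1 0 x - (x 0 ^ 2 - x 1 ^ 2) / 2)
    + 4 * e1 ^ 2 * (x 5 ^ 2 + x 8 ^ 2 + x 3 ^ 2 + x 6 ^ 2) - 4 * lam * (x 2 + lam)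
    + 8 * lam * e1 * x 4 - 2 * e1 ^ 2 * (nA2 x + nB2 x)

/-- Coefficient of `M₁M₂` in the expansion of `Φ₂` near `M₁ = M₂ = 0`. -/
def Phi2CoeffM1M2 (lam e1 : ℝ) : V9 → ℝ := fun x =>
  8 * (Z2 e1 0 x - x 0 * x 1) - 8 * lam * e1 * (x 3 - x 7)
    + 8 * e1 ^ 2 * (x 3 * x 4 + x 6 * x 7)

/-- Coefficient of `M₂²` in the expansion of `Φ₂` near `M₁ = M₂ = 0`. -/
def Phi2CoeffSqM2 (lam e1 : ℝ) : V9 → ℝ := fun x =>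
  x 0 ^ 2 + x 1 ^ 2 - 4 * (Z1 e1 0 x - (x 0 ^ 2 - x 1 ^ 2) / 2)
    + 4 * e1 ^ 2 * (x 5 ^ 2 + x 8 ^ 2 + x 4 ^ 2 + x 7 ^ 2) - 4 * lam * (x 2 + lam)
    - 8 * lam * e1 * x 6 - 2 * e1 ^ 2 * (nA2 x + nB2 x)

/-- `Φ₂` lies in the square of the ideal generated by `M₁` and `M₂`. -/
theorem Phi2_eq_quadratic (lam e1 : ℝ) :
    Phi2 lam e1 = fun x => x 0 * (x 0 * Phi2CoeffSqM1 lam e1 x + x 1 * Phi2CoeffM1M2 lam e1 x)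
      + x 1 * (x 1 * Phi2CoeffSqM2 lam e1 x) := by
  funext x
  simp only [Phi2, Phi2CoeffSqM1, Phi2CoeffM1M2, Phi2CoeffSqM2, Kfun, Gfun, Hfun, Z1, Z2,
    nA2, nB2, dotAB, wA, wB, wG]
  ring

/-- A product of two differentiable functions has zero derivative at a common zero. -/
theorem hasFDerivAt_mul_of_eq_zero {f g : V9 → ℝ} {x : V9} (hf : DifferentiableAt ℝ f x)
    (hg : DifferentiableAt ℝ g x) (hfx : f x = 0) (hgx : g x = 0) :
    HasFDerivAt (fun y => f y * g y) (0 : V9 →L[ℝ] ℝ) x := by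
  simpa [hfx, hgx] using hf.hasFDerivAt.fun_mul hg.hasFDerivAt

/-- The differential of `Φ₂` vanishes where `M₁ = M₂ = 0`. -/
theorem fderiv_Phi2_eq_zero (lam e1 : ℝ) (x : V9) (h1 : x 0 = 0) (h2 : x 1 = 0) :
    fderiv ℝ (Phi2 lam e1) x = 0 := by
  have hP : Differentiable ℝ (Phi2CoeffSqM1 lam e1) := by
    unfold Phi2CoeffSqM1 Z1 nA2 nB2; fun_prop
  have hQ : Differentiable ℝ (Phi2CoeffM1M2 lam e1) := by
    unfold Phi2CoeffM1M2 Z2 dotAB; fun_prop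
  have hR : Differentiable ℝ (Phi2CoeffSqM2 lam e1) := by
    unfold Phi2CoeffSqM2 Z1 nA2 nB2; fun_prop
  rw [Phi2_eq_quadratic]
  have hsum := (hasFDerivAt_mul_of_eq_zero (f := fun y => y 0)
      (g := fun y => y 0 * Phi2CoeffSqM1 lam e1 y + y 1 * Phi2CoeffM1M2 lam e1 y)
      (x := x) (by fun_prop) (by fun_prop) h1 (by simp [h1, h2])).fun_add
    (hasFDerivAt_mul_of_eq_zero (f := fun y => y 1) (g := fun y => y 1 * Phi2CoeffSqM2 lam e1 y)
      (x := x) (by fun_prop) (by fun_prop) h2 (by simp [h2]))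
  simpa using hsum.fderiv

/-- For `ε₂ = 0`, the Hamiltonian vector field `sgrad Φ₂` vanishes on the invariant set
`M_{L₂} = {M₁ = M₂ = 0}`. -/
theorem sgrad_Phi2_vanishes (lam e1 : ℝ) (x : V9) (h1 : x 0 = 0) (h2 : x 1 = 0) :
    ∀ j : Fin 9, sgrad (Phi2 lam e1) x j = 0 := by
  intro j
  simp [sgrad, pb, pd, fderiv_Phi2_eq_zero lam e1 x h1 h2]
end
end

section
/- For ε₂ = 0, the Hamiltonian vector field of Φ₁ vanishes on the critical subsystem M_{L₁}: at every point x ∈ ℝ⁹ with F₁(x) = 0 and F₂(x) = 0, all nine components {Φ₁,M_i}(x), {Φ₁,α_i}(x), {Φ₁,β_i}(x) (i = 1,2,3) of sgrad Φ₁ are zero, for all real values of λ and ε₁. -/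
noncomputable section

/-- The integral `Φ₁ = ε₁²G + K − ε₁⁴(α·β)² − ¼[H² + 2ε₁²(|α|²+|β|²)H + ε₁⁴(|α|²−|β|²)²]`
(for `ε₂ = 0`). -/
def Phi1 (lam e1 : ℝ) : V9 → ℝ := fun x =>
  e1 ^ 2 * Gfun lam e1 0 x + Kfun lam e1 0 x - e1 ^ 4 * dotAB x ^ 2
    - (Hfun lam e1 0 x ^ 2 + 2 * e1 ^ 2 * (nA2 x + nB2 x) * Hfun lam e1 0 x
        + e1 ^ 4 * (nA2 x - nB2 x) ^ 2) / 4

/-- The invariant relation `F₁ = M₃ + λ + ε₁(β₁ − α₂)`. -/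
def F1 (lam e1 : ℝ) : V9 → ℝ := fun x => x 2 + lam + e1 * (x 6 - x 4)

/-- The invariant relation `F₂`. -/
def F2 (lam e1 : ℝ) : V9 → ℝ := fun x =>
  x 2 ^ 3 + (e1 * (x 6 - x 4) + lam) * x 2 ^ 2
    + (x 0 ^ 2 + x 1 ^ 2 + 2 * e1 * (x 5 * x 1 - x 8 * x 0)) * x 2
    + e1 * ((x 1 ^ 2 - x 0 ^ 2) * (x 4 + x 6) + 2 * x 0 * x 1 * (x 3 - x 7))
    + lam * (x 0 ^ 2 + x 1 ^ 2)

/-- The integral `Φ₁` factors through the invariant relations. -/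
theorem Phi1_eq_neg_mul (lam e1 : ℝ) : Phi1 lam e1 = fun x => -(F1 lam e1 x * F2 lam e1 x) := by
  funext x
  simp only [Phi1, Gfun, Kfun, Hfun, Z1, Z2, nA2, nB2, dotAB, wA, wB, wG, F1, F2]
  ring

theorem differentiable_F1 (lam e1 : ℝ) : Differentiable ℝ (F1 lam e1) := by
  unfold F1
  fun_prop

theorem differentiable_F2 (lam e1 : ℝ) : Differentiable ℝ (F2 lam e1) := by
  unfold F2
  fun_prop

theorem fderiv_mul_eq_zero_of_eq_zero {f g : V9 → ℝ} {x : V9} (hf : DifferentiableAt ℝ f x)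
    (hg : DifferentiableAt ℝ g x) (hfx : f x = 0) (hgx : g x = 0) :
    fderiv ℝ (fun y => f y * g y) x = 0 := by
  simp [fderiv_fun_mul hf hg, hfx, hgx]

/-- The Hamiltonian vector field of a function vanishes at its critical points. -/
theorem sgrad_eq_zero_of_fderiv_eq_zero {f : V9 → ℝ} {x : V9} (hf : fderiv ℝ f x = 0) :
    sgrad f x = 0 := by
  funext j
  simp [sgrad, pb, pd, hf]

/-- For `ε₂ = 0`, the Hamiltonian vector field `sgrad Φ₁` vanishes on the critical subsystem
`M_{L₁} = {F₁ = 0, F₂ = 0}`. -/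
theorem sgrad_Phi1_vanishes (lam e1 : ℝ) (x : V9)
    (h1 : F1 lam e1 x = 0) (h2 : F2 lam e1 x = 0) :
    ∀ j : Fin 9, sgrad (Phi1 lam e1) x j = 0 := by
  refine congrFun (sgrad_eq_zero_of_fderiv_eq_zero ?_)
  rw [Phi1_eq_neg_mul, fderiv_fun_neg, fderiv_mul_eq_zero_of_eq_zero (differentiable_F1 lam e1 x)
    (differentiable_F2 lam e1 x) h1 h2, neg_zero]
end
end

section
/- The parametric equations (12) describe the discriminant surface of the polynomial d₀: let a, b, c, ε₁, ε₂, h, t ∈ ℝ with ε₂ ≠ 0 and t ≠ 0, and set g = (ht² − 2t³)/ε₂² + 2ε₂²(a²b² − c²)/t and k = 3t² − 2ht + ε₁²(2t³ − ht²)/ε₂² + ε₂²(c² − a²b²)(2ε₁²t + ε₂²)/t² + ¼{h² + 2ε₁²(a²+b²)h + ε₁⁴[(a²−b²)² + 4c²] + 4ε₂²(a²+b²)}. Then t is a multiple root of the quartic polynomial p(T) = −T⁴ + hT³ + fT² + ε₂²gT − ε₂⁴(a²b² − c²), where f = ε₁²g + k − ε₁⁴c² − ¼[h² + 2ε₁²(a²+b²)h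 + ε₁⁴(a²−b²)²] − ε₂²(a²+b²); that is, p(t) = 0 and p′(t) = 0. -/
noncomputable section

open Polynomial

/-- The parametric equations (12) describe the discriminant surface of the polynomial `d₀`:
with `g`, `k` given parametrically in terms of `t`, the parameter `t` is a multiple root of
the quartic `p(T) = −T⁴ + hT³ + fT² + ε₂²gT − ε₂⁴(a²b² − c²)`. -/
theorem discriminant_surface (a b c e1 e2 h t g k f : ℝ) (he2 : e2 ≠ 0) (ht : t ≠ 0)
    (hg : g = (h * t ^ 2 - 2 * t ^ 3) / e2 ^ 2 + 2 * e2 ^ 2 * (a ^ 2 * b ^ 2 - c ^ 2) / t)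
    (hk : k = 3 * t ^ 2 - 2 * h * t + e1 ^ 2 * (2 * t ^ 3 - h * t ^ 2) / e2 ^ 2
      + e2 ^ 2 * (c ^ 2 - a ^ 2 * b ^ 2) * (2 * e1 ^ 2 * t + e2 ^ 2) / t ^ 2
      + (h ^ 2 + 2 * e1 ^ 2 * (a ^ 2 + b ^ 2) * h
          + e1 ^ 4 * ((a ^ 2 - b ^ 2) ^ 2 + 4 * c ^ 2) + 4 * e2 ^ 2 * (a ^ 2 + b ^ 2)) / 4)
    (hf : f = e1 ^ 2 * g + k - e1 ^ 4 * c ^ 2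
      - (h ^ 2 + 2 * e1 ^ 2 * (a ^ 2 + b ^ 2) * h + e1 ^ 4 * (a ^ 2 - b ^ 2) ^ 2) / 4
      - e2 ^ 2 * (a ^ 2 + b ^ 2)) :
    let p : Polynomial ℝ := -X ^ 4 + C h * X ^ 3 + C f * X ^ 2 + C (e2 ^ 2 * g) * X
      - C (e2 ^ 4 * (a ^ 2 * b ^ 2 - c ^ 2))
    p.eval t = 0 ∧ (derivative p).eval t = 0 := by
  have hf' : f = 3 * t ^ 2 - 2 * h * t - e2 ^ 4 * (a ^ 2 * b ^ 2 - c ^ 2) / t ^ 2 := by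
    rw [hf, hk, hg]
    field_simp
    ring
  have hg' : e2 ^ 2 * g = h * t ^ 2 - 2 * t ^ 3 + 2 * e2 ^ 4 * (a ^ 2 * b ^ 2 - c ^ 2) / t := by
    rw [hg]
    field_simp
  intro p
  constructor
  · simp only [p, eval_sub, eval_add, eval_neg, eval_mul, eval_pow, eval_X, eval_C]
    rw [hf', hg']
    field_simp
    ring
  · simp only [p, derivative_sub, derivative_add, derivative_neg, derivative_C_mul,
      derivative_X_pow, derivative_X, derivative_C, eval_sub, eval_add, eval_neg, eval_mul,
      eval_pow, eval_X, eval_C, eval_one, eval_zero]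
    rw [hf', hg']
    field_simp
    push_cast
    ring
end
end
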